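/- A distal topological dynamical system (X, T) on a compact metric space has zero topological entropy. -/

import Mathlib

open Filter Topology Dynamics Set

theorem dz_ultra_const {α K : Type*} [Finite K] (u : Ultrafilter α) (g : α → K) :
    ∃ a, ∀ᶠ m in (u : Filter α), g m = a := by
  obtain ⟨a, ha⟩ := Ultrafilter.eq_pure_of_finite (u.map g)
  refine ⟨a, ?_⟩
  have h : ({a} : Set K) ∈ u.map g := by rw [ha]; exact Set.mem_singleton a
  exact h

theorem dz_ultra_lim {α X : Type*} [TopologicalSpace X] [CompactSpace X]
    (u : Ultrafilter α) (g : α → X) : ∃ x, Tendsto g u (𝓝 x) :=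
  ⟨(u.map g).lim, (u.map g).le_nhds_lim⟩

attribute [local instance] Ultrafilter.add Ultrafilter.addSemigroup in
/-- In a distal system every point returns along a fixed idempotent ultrafilter. -/
theorem dz_recurrent {X : Type*} [MetricSpace X] [CompactSpace X]
    (T : X → X) (hT : Continuous T)
    (hdistal : ∀ x y : X, x ≠ y → ∃ c > 0, ∀ n : ℕ, c ≤ dist (T^[n] x) (T^[n] y)) :
    ∃ u : Ultrafilter ℕ+, ∀ x, Tendsto (fun s : ℕ+ => T^[(s : ℕ)] x) u (𝓝 x) := by
  obtain ⟨u, hu⟩ := exists_idempotent_of_compact_t2_of_continuous_add_left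
    (M := Ultrafilter ℕ+) Ultrafilter.continuous_add_left
  refine ⟨u, fun x => ?_⟩
  obtain ⟨y, hy⟩ := dz_ultra_lim u (fun s : ℕ+ => T^[(s : ℕ)] x)
  obtain ⟨z, hz⟩ := dz_ultra_lim u (fun s : ℕ+ => T^[(s : ℕ)] y)
  have hyz : z = y := by
    by_contra hne
    obtain ⟨V, W, hV, hW, hzV, hyW, hVW⟩ := t2_separation hne
    have h1 : ∀ᶠ s : ℕ+ in (u : Filter ℕ+), T^[(s : ℕ)] y ∈ V := hz.eventually (hV.mem_nhds hzV)
    have h2 : ∀ᶠ s : ℕ+ in ((u + u : Ultrafilter ℕ+) : Filter ℕ+), T^[(s : ℕ)] x ∈ W := by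
      rw [hu]; exact hy.eventually (hW.mem_nhds hyW)
    rw [Ultrafilter.eventually_add] at h2
    obtain ⟨s, hs1, hs2⟩ := (h1.and h2).exists
    have h3 : ∀ᶠ t : ℕ+ in (u : Filter ℕ+), T^[(s : ℕ)] (T^[(t : ℕ)] x) ∈ V :=
      ((hT.iterate s).continuousAt.tendsto.comp hy).eventually (hV.mem_nhds hs1)
    obtain ⟨t, ht1, ht2⟩ := (h3.and hs2).exists
    rw [PNat.add_coe, Function.iterate_add_apply] at ht2
    exact Set.disjoint_left.1 hVW ht1 ht2
  subst hyz
  have hxz : x = z := by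
    by_contra hne
    obtain ⟨c, hc, h⟩ := hdistal x z hne
    have h0 := hy.dist hz
    rw [dist_self] at h0
    obtain ⟨s, hs⟩ := (h0.eventually (gt_mem_nhds hc)).exists
    exact absurd (h s) (not_le.2 hs)
  rw [← hxz] at hy
  exact hy

open Classical in
/-- The code of a point: which of the closed balls of radius `r` around `Z` contain it. -/
noncomputable def dzCode {X : Type*} [MetricSpace X] (Z : Finset X) (r : ℝ) (x : X) : Z → Bool :=
  fun z => decide (dist x z ≤ r)

theorem dz_code_of_closed {X : Type*} [MetricSpace X] (Z : Finset X) (r : ℝ) (x : X)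
    (a : Z → Bool) (hg : ∀ z ∈ Z, dist x z ≠ r)
    (h1 : ∀ z : Z, a z = true → dist x z ≤ r) (h2 : ∀ z : Z, a z = false → r ≤ dist x z) :
    dzCode Z r x = a := by
  funext z
  rcases h : a z with _ | _
  · have := lt_of_le_of_ne (h2 z h) (Ne.symm (hg z z.2))
    simp [dzCode, this]
  · simp [dzCode, h1 z h]

/-- limits of points with a given code lie in the closed code set -/
theorem dz_code_lim {X α : Type*} [MetricSpace X] (Z : Finset X) (r : ℝ)
    (u : Ultrafilter α) (g : α → X) (x : X) (hx : Tendsto g u (𝓝 x)) (a : Z → Bool)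
    (ha : ∀ᶠ m in (u : Filter α), 
      (∀ z : Z, a z = true → dist (g m) z ≤ r) ∧ (∀ z : Z, a z = false → r ≤ dist (g m) z)) :
    (∀ z : Z, a z = true → dist x z ≤ r) ∧ (∀ z : Z, a z = false → r ≤ dist x z) := by
  constructor
  · intro z hz
    exact le_of_tendsto (hx.dist tendsto_const_nhds) (ha.mono fun m hm => hm.1 z hz)
  · intro z hz
    exact ge_of_tendsto (hx.dist tendsto_const_nhds) (ha.mono fun m hm => hm.2 z hz)

theorem dz_code_self {X : Type*} [MetricSpace X] (Z : Finset X) (r : ℝ) (x : X) (a : Z → Bool)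
    (h : dzCode Z r x = a) :
    (∀ z : Z, a z = true → dist x z ≤ r) ∧ (∀ z : Z, a z = false → r ≤ dist x z) := by
  subst h
  constructor
  · intro z hz
    simpa [dzCode] using hz
  · intro z hz
    have : r < dist x z := by simpa [dzCode] using hz
    exact this.le

theorem dz_predict {X : Type*} [MetricSpace X] [CompactSpace X]
    (T : X → X) (hT : Continuous T)
    (hdistal : ∀ x y : X, x ≠ y → ∃ c > 0, ∀ n : ℕ, c ≤ dist (T^[n] x) (T^[n] y))
    (Z : Finset X) (r η : ℝ) (hη : 0 < η) :
    ∃ M : ℕ, ∀ x y : X, (∀ z ∈ Z, η ≤ |dist x z - r|) → (∀ z ∈ Z, η ≤ |dist y z - r|) →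
      (∀ s, 1 ≤ s → s ≤ M → dzCode Z r (T^[s] x) = dzCode Z r (T^[s] y)) →
      dzCode Z r x = dzCode Z r y := by
  obtain ⟨u, hu⟩ := dz_recurrent T hT hdistal
  by_contra! hcon
  choose x y hx hy hxy hne using hcon
  let h : Ultrafilter ℕ := hyperfilter ℕ
  have hle : (h : Filter ℕ) ≤ atTop := Nat.hyperfilter_le_atTop
  choose ω hω using fun s : ℕ => dz_ultra_const h (fun m => dzCode Z r (T^[s] (x m)))
  have key : ∀ w : ℕ → X, (∀ m, ∀ z ∈ Z, η ≤ |dist (w m) z - r|) →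
      (∀ s : ℕ+, ∀ᶠ m in (h : Filter ℕ), dzCode Z r (T^[(s : ℕ)] (w m)) = ω s) →
      ∀ i, (∀ᶠ s : ℕ+ in (u : Filter ℕ+), ω s = i) →
      ∀ᶠ m in (h : Filter ℕ), dzCode Z r (w m) = i := by
    intro w hw hs i hi
    obtain ⟨p, hp⟩ := dz_ultra_lim h w
    obtain ⟨a, ha⟩ := dz_ultra_const h (fun m => dzCode Z r (w m))
    have hgood : ∀ z ∈ Z, dist p z ≠ r := by
      intro z hz heq
      have : η ≤ |dist p z - r| :=
        ge_of_tendsto (((hp.dist tendsto_const_nhds).sub_const r).abs)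
          (Eventually.of_forall fun m => hw m z hz)
      rw [heq, sub_self, abs_zero] at this
      linarith
    have h1 := dz_code_lim Z r h w p hp a (ha.mono fun m hm => dz_code_self Z r _ _ hm)
    have h2 := dz_code_lim Z r u _ p (hu p) i (hi.mono fun s hs' =>
      dz_code_lim Z r h (fun m => T^[(s : ℕ)] (w m)) _
        ((hT.iterate s).continuousAt.tendsto.comp hp) i
        ((hs s).mono fun m hm => dz_code_self Z r _ _ (hm.trans hs')))
    have e1 := dz_code_of_closed Z r p a hgood h1.1 h1.2
    have e2 := dz_code_of_closed Z r p i hgood h2.1 h2.2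
    rw [← e2, e1]
    exact ha
  obtain ⟨i, hi⟩ := dz_ultra_const u (fun s : ℕ+ => ω s)
  have kx := key x hx (fun s => hω s) i hi
  have ky := key y hy (fun s => by
    filter_upwards [hω s, hle (eventually_ge_atTop (s : ℕ))] with m hm hm2
    rw [← hxy m s s.2 hm2]; exact hm) i hi
  obtain ⟨m, h1, h2⟩ := (kx.and ky).exists
  exact hne m (h1.trans h2.symm)

theorem dz_cover {X D : Type*} (T : X → X) (U : SetRel X X) (n : ℕ) (φ : X → D)
    (S : Finset D) (hS : ∀ x, φ x ∈ S)
    (h : ∀ x y, φ x = φ y → ∀ t < n, (T^[t] x, T^[t] y) ∈ U) :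
    coverMincard T Set.univ U n ≤ S.card := by
  classical
  rcases isEmpty_or_nonempty X with hX | hX
  · have : (Set.univ : Set X) = ∅ := Set.univ_eq_empty_iff.2 hX
    rw [this, coverMincard_empty]; exact zero_le
  let ψ : D → X := Function.invFun φ
  have hc : IsDynCoverOf T Set.univ U n ((S.image ψ : Finset X) : Set X) := by
    intro x _
    refine ⟨ψ (φ x), ?_, ?_⟩
    · exact Finset.mem_coe.2 (Finset.mem_image_of_mem _ (hS x))
    · exact mem_dynEntourage.2 (h _ _ (Function.invFun_eq ⟨x, rfl⟩).symm)
  exact hc.coverMincard_le_card.trans (by exact_mod_cast Finset.card_image_le)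

theorem dz_count {K : Type*} [Fintype K] (n k L q : ℕ) (a : ℝ) (hq : 0 < q)
    (hL : 0 < L)
    (h1 : (Fintype.card K : ℝ) / q ≤ a / 2) (h2 : (k : ℝ) / L * Real.log q ≤ a / 2)
    (S : Finset (Fin n → Option K))
    (hS : ∀ f ∈ S, L * (Finset.univ.filter fun t => f t ≠ none).card ≤ k * n) :
    (S.card : ℝ) ≤ Real.exp (a * n) := by
  classical
  have hq' : (0 : ℝ) < q := by exact_mod_cast hq
  have hL' : (0 : ℝ) < L := by exact_mod_cast hL
  let w : Option K → ℝ := fun o => if o ≠ none then (q : ℝ)⁻¹ else 1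
  have hw : ∀ o, 0 < w o := by intro o; simp only [w]; split_ifs <;> positivity
  have hsum : ∑ o, w o = 1 + (Fintype.card K : ℝ) / q := by
    rw [Fintype.sum_option]; simp [w, div_eq_mul_inv]
  have htot : ∑ f : Fin n → Option K, ∏ t, w (f t) = (1 + (Fintype.card K : ℝ) / q) ^ n := by
    rw [← hsum]
    have := Finset.prod_univ_sum (fun _ : Fin n => (Finset.univ : Finset (Option K)))
      (fun _ o => w o)
    simp only [Finset.prod_const, Finset.card_univ, Fintype.card_fin,
      Fintype.piFinset_univ] at this
    exact this.symm
  have hle : ∀ f ∈ S, Real.exp (-(a / 2 * n)) ≤ ∏ t, w (f t) := by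
    intro f hf
    have e : ∏ t, w (f t) = ((q : ℝ)⁻¹) ^ (Finset.univ.filter fun t => f t ≠ none).card := by
      simp only [w]
      rw [Finset.prod_ite]; simp
    set c := (Finset.univ.filter fun t => f t ≠ none).card with hc
    have hcl : (L : ℝ) * c ≤ k * n := by exact_mod_cast hS f hf
    have hcc : (c : ℝ) ≤ k / L * n := by
      rw [div_mul_eq_mul_div, le_div_iff₀ hL']; linarith
    have hlog : 0 ≤ Real.log q := Real.log_natCast_nonneg q
    rw [e, ← Real.exp_log (pow_pos (inv_pos.2 hq') c), Real.log_pow, Real.log_inv]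
    apply Real.exp_le_exp.2
    have := mul_le_mul_of_nonneg_right hcc hlog
    have h3 := mul_le_mul_of_nonneg_right h2 (Nat.cast_nonneg (α := ℝ) n)
    nlinarith
  have hS2 : (S.card : ℝ) * Real.exp (-(a / 2 * n)) ≤ Real.exp (a / 2) ^ n := by
    calc (S.card : ℝ) * Real.exp (-(a / 2 * n)) = ∑ f ∈ S, Real.exp (-(a / 2 * n)) := by simp
      _ ≤ ∑ f ∈ S, ∏ t, w (f t) := Finset.sum_le_sum hle
      _ ≤ ∑ f : Fin n → Option K, ∏ t, w (f t) :=
        Finset.sum_le_univ_sum_of_nonneg fun f => (Finset.prod_pos fun t _ => hw _).le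
      _ = (1 + (Fintype.card K : ℝ) / q) ^ n := htot
      _ ≤ Real.exp (a / 2) ^ n := by
        apply pow_le_pow_left₀ (by positivity)
        have := Real.add_one_le_exp (a / 2)
        linarith
  rw [← Real.exp_nat_mul] at hS2
  calc (S.card : ℝ) = (S.card : ℝ) * Real.exp (-(a / 2 * n)) * Real.exp (a / 2 * n) := by
        rw [mul_assoc, ← Real.exp_add]; simp
    _ ≤ Real.exp (n * (a / 2)) * Real.exp (a / 2 * n) := by gcongr
    _ = Real.exp (a * n) := by rw [← Real.exp_add]; congr 1; ring

/-- The bad set: points close to the boundary of one of the balls. -/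
def DzBad {X : Type*} [MetricSpace X] (Z : Finset X) (r η : ℝ) (x : X) : Prop :=
  ∃ z ∈ Z, |dist x z - r| < η

open Classical in
theorem dz_bad_few {X : Type*} [MetricSpace X] (Z : Finset X) (L : ℕ)
    (η ρ : ℝ) (x : X) :
    ((Finset.range L).filter fun j : ℕ => DzBad Z (ρ + 2 * η * j) η x).card ≤ Z.card := by
  have hsub : ((Finset.range L).filter fun j : ℕ => DzBad Z (ρ + 2 * η * j) η x) ⊆
      Z.biUnion fun z => (Finset.range L).filter fun j : ℕ =>
        |dist x z - (ρ + 2 * η * j)| < η := by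
    intro j hj
    rw [Finset.mem_filter] at hj
    obtain ⟨hj, z, hz, h⟩ := hj
    rw [Finset.mem_biUnion]
    exact ⟨z, hz, Finset.mem_filter.2 ⟨hj, h⟩⟩
  refine (Finset.card_le_card hsub).trans ?_
  refine (Finset.card_biUnion_le_card_mul _ _ 1 fun z _ => ?_).trans (by simp)
  rw [Finset.card_le_one]
  intro i hi j hj
  have h1 := (Finset.mem_filter.1 hi).2
  have h2 := (Finset.mem_filter.1 hj).2
  have hη : 0 < η := (abs_nonneg _).trans_lt h1
  rw [abs_lt] at h1 h2
  have h3 : (i : ℝ) - j < 1 := by nlinarith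
  have h4 : (j : ℝ) - i < 1 := by nlinarith
  have h5 : i < j + 1 := by exact_mod_cast (by linarith : (i : ℝ) < j + 1)
  have h6 : j < i + 1 := by exact_mod_cast (by linarith : (j : ℝ) < i + 1)
  omega

open Classical in
/-- Each point has a radius for which few visits to the bad annuli occur. -/
theorem dz_radius {X : Type*} [MetricSpace X] (T : X → X) (Z : Finset X) (L n : ℕ) (hL : 0 < L)
    (η ρ : ℝ) (x : X) :
    ∃ j : Fin L, L * (Finset.univ.filter fun t : Fin n =>
      DzBad Z (ρ + 2 * η * (j : ℕ)) η (T^[t] x)).card ≤ Z.card * n := by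
  by_contra! hcon
  have : Nonempty (Fin L) := ⟨⟨0, hL⟩⟩
  have h1 : ∑ j : Fin L, Z.card * n < ∑ j : Fin L, L * (Finset.univ.filter fun t : Fin n =>
      DzBad Z (ρ + 2 * η * (j : ℕ)) η (T^[t] x)).card :=
    Finset.sum_lt_sum_of_nonempty Finset.univ_nonempty fun j _ => hcon j
  have h2 : ∑ j : Fin L, (Finset.univ.filter fun t : Fin n =>
      DzBad Z (ρ + 2 * η * (j : ℕ)) η (T^[t] x)).card ≤ Z.card * n := by
    simp only [Finset.card_filter]
    rw [Finset.sum_comm]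
    calc _ ≤ ∑ t : Fin n, Z.card := by
          refine Finset.sum_le_sum fun t _ => ?_
          have := dz_bad_few Z L η ρ (T^[t] x)
          rw [Finset.card_filter, Finset.sum_range] at this
          exact this
      _ = _ := by simp [mul_comm]
  rw [Finset.sum_const, Finset.card_univ, Fintype.card_fin, smul_eq_mul, ← Finset.mul_sum] at h1
  exact absurd h1 (not_lt.2 (Nat.mul_le_mul_left L h2))

open Classical in
theorem dz_bound {X : Type*} [MetricSpace X] [CompactSpace X]
    (T : X → X) (hT : Continuous T)
    (hdistal : ∀ x y : X, x ≠ y → ∃ c > 0, ∀ n : ℕ, c ≤ dist (T^[n] x) (T^[n] y))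
    (U : SetRel X X) (ε : ℝ) (hε : 0 < ε) (hU : ∀ x y, dist x y < ε → (x, y) ∈ U)
    (a : ℝ) (ha : 0 < a) :
    ∃ C : ℕ, ∀ n : ℕ, ∃ m : ℕ, coverMincard T Set.univ U n ≤ (C * m : ℕ) ∧
      (m : ℝ) ≤ Real.exp (a * n) := by
  set ρ := ε / 4 with hρ
  have hρ0 : 0 < ρ := by positivity
  obtain ⟨Z, hZ⟩ : ∃ Z : Finset X, ∀ x, ∃ z ∈ Z, dist x z < ρ := by
    obtain ⟨t, -, ht⟩ := (isCompact_univ : IsCompact (Set.univ : Set X)).elim_nhds_subcover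
      (fun x => Metric.ball x ρ) (fun x _ => Metric.ball_mem_nhds x hρ0)
    refine ⟨t, fun x => ?_⟩
    simpa using ht (Set.mem_univ x)
  obtain ⟨q, hq⟩ := exists_nat_gt (max 0 ((Fintype.card (Z → Bool) : ℝ) / (a / 2)))
  have hq0 : (0 : ℝ) < q := (le_max_left _ _).trans_lt hq
  have hq1 : (Fintype.card (Z → Bool) : ℝ) / q ≤ a / 2 := by
    have := (le_max_right _ _).trans_lt hq
    rw [div_lt_iff₀ (by positivity)] at this
    rw [div_le_iff₀ hq0]; linarith
  obtain ⟨L, hL⟩ := exists_nat_gt (max 0 ((Z.card : ℝ) * Real.log q / (a / 2)))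
  have hL0 : (0 : ℝ) < L := (le_max_left _ _).trans_lt hL
  have hL1 : (Z.card : ℝ) / L * Real.log q ≤ a / 2 := by
    have := (le_max_right _ _).trans_lt hL
    rw [div_lt_iff₀ (by positivity)] at this
    rw [div_mul_eq_mul_div, div_le_iff₀ hL0]; linarith
  have hLn : 0 < L := by exact_mod_cast hL0
  set η := ρ / (2 * L) with hη
  have hη0 : 0 < η := by positivity
  choose M' hM' using fun j : Fin L =>
    dz_predict T hT hdistal Z (ρ + 2 * η * (j : ℕ)) η hη0
  set M := Finset.univ.sup M' with hM
  refine ⟨L * Fintype.card (Fin M → Z → Bool), fun n => ?_⟩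
  choose J hJ using dz_radius T Z L n hLn η ρ
  let R : Fin L → ℝ := fun j => ρ + 2 * η * (j : ℕ)
  let F : X → Fin n → Option (Z → Bool) := fun x t =>
    if DzBad Z (R (J x)) η (T^[t] x) then some (dzCode Z (R (J x)) (T^[t] x)) else none
  let G : X → Fin M → Z → Bool := fun x s => dzCode Z (R (J x)) (T^[n + s] x)
  let S : Finset (Fin n → Option (Z → Bool)) := Finset.univ.filter fun f =>
    L * (Finset.univ.filter fun t => f t ≠ none).card ≤ Z.card * n
  refine ⟨S.card, ?_, dz_count n Z.card L q a (by exact_mod_cast hq0) hLn hq1 hL1 S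
    fun f hf => (Finset.mem_filter.1 hf).2⟩
  have hcov := dz_cover T U n (fun x => ((J x, G x), F x))
    ((Finset.univ : Finset (Fin L × (Fin M → Z → Bool))) ×ˢ S) ?_ ?_
  · rw [Finset.card_product, Finset.card_univ, Fintype.card_prod, Fintype.card_fin] at hcov
    exact hcov
  · intro x
    refine Finset.mem_product.2 ⟨Finset.mem_univ _, Finset.mem_filter.2 ⟨Finset.mem_univ _, ?_⟩⟩
    refine le_trans (le_of_eq ?_) (hJ x)
    congr 2
    ext t
    simp [F, R]
  · intro x y hxy
    obtain ⟨⟨hj, hG⟩, hF⟩ : (J x = J y ∧ G x = G y) ∧ F x = F y := by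
      simpa only [Prod.mk.injEq] using hxy
    have hcode : ∀ d t, t + d = n + M →
        ∀ t', t ≤ t' → t' < n + M → dzCode Z (R (J x)) (T^[t'] x) = dzCode Z (R (J x)) (T^[t'] y) := by
      intro d
      induction d with
      | zero => intro t ht t' h1 h2; omega
      | succ d ih =>
        intro t ht t' h1 h2
        rcases h1.lt_or_eq with h1 | rfl
        · exact ih (t + 1) (by omega) t' h1 h2
        by_cases htn : n ≤ t
        · have := congrFun hG ⟨t - n, by omega⟩
          simp only [G, ← hj] at this
          rwa [Nat.add_sub_cancel' htn] at this
        push Not at htn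
        have hFt := congrFun hF ⟨t, htn⟩
        simp only [F, ← hj] at hFt
        by_cases hbx : DzBad Z (R (J x)) η (T^[t] x)
        · by_cases hby : DzBad Z (R (J x)) η (T^[t] y)
          · simpa [hbx, hby] using hFt
          · simp [hbx, hby] at hFt
        · by_cases hby : DzBad Z (R (J x)) η (T^[t] y)
          · simp [hbx, hby] at hFt
          · simp only [DzBad, not_exists, not_and, not_lt] at hbx hby
            refine hM' (J x) _ _ hbx hby fun s hs1 hs2 => ?_
            have hsM : s ≤ M := hs2.trans (Finset.le_sup (Finset.mem_univ (J x)))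
            rw [← Function.iterate_add_apply, ← Function.iterate_add_apply]
            exact ih (t + 1) (by omega) (s + t) (by omega) (by omega)
    intro t ht
    have hc := hcode (n + M) 0 (by omega) t (Nat.zero_le _) (by omega)
    obtain ⟨z, hz, hzx⟩ := hZ (T^[t] x)
    have hjL : ((J x : ℕ) : ℝ) + 1 ≤ L := by exact_mod_cast (J x).2
    have hηL : 2 * η * L = ρ := by rw [hη]; field_simp
    have hR1 : ρ ≤ R (J x) := by
      have : 0 ≤ 2 * η * ((J x : ℕ) : ℝ) := by positivity
      simp only [R]; linarith
    have hR2 : R (J x) < 2 * ρ := by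
      simp only [R]; nlinarith
    have hx1 : dist (T^[t] x) z ≤ R (J x) := hzx.le.trans hR1
    have hy1 : dist (T^[t] y) z ≤ R (J x) := by
      have := congrFun hc ⟨z, hz⟩
      simpa [dzCode, hx1] using this.symm
    apply hU
    have := dist_triangle_right (T^[t] x) (T^[t] y) z
    linarith

/-- A distal topological dynamical system on a compact metric space has zero
topological entropy. -/
theorem distal_zero_entropy {X : Type*} [MetricSpace X] [CompactSpace X] [Nonempty X]
    (T : X → X) (hT : Continuous T)
    (hdistal : ∀ x y : X, x ≠ y → ∃ c > 0, ∀ n : ℕ, c ≤ dist (T^[n] x) (T^[n] y)) :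
    Dynamics.coverEntropy T Set.univ = 0 := by
  refine le_antisymm ?_ (coverEntropy_nonneg T Set.univ_nonempty)
  refine iSup₂_le fun U hU => ?_
  obtain ⟨ε, hε, hεU⟩ := Metric.mem_uniformity_dist.1 hU
  refine EReal.le_of_forall_lt_iff_le.1 fun a ha => ?_
  have ha' : (0 : ℝ) < a := by exact_mod_cast ha
  obtain ⟨C, hC⟩ := dz_bound T hT hdistal U ε hε (fun x y h => hεU h) a ha'
  have hle : ∀ n : ℕ, ((coverMincard T Set.univ U n : ℕ∞) : ENNReal) ≤
      (C : ENNReal) * EReal.exp ((a : EReal) * n) := by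
    intro n
    obtain ⟨m, h1, h2⟩ := hC n
    calc ((coverMincard T Set.univ U n : ℕ∞) : ENNReal) ≤ (((C * m : ℕ) : ℕ∞) : ENNReal) :=
          ENat.toENNReal_mono h1
      _ = (C : ENNReal) * (m : ENNReal) := by simp
      _ ≤ _ := by
        gcongr
        have e : ((a : EReal) * n) = ((a * n : ℝ) : EReal) := by push_cast; rfl
        rw [e, EReal.exp_coe, ← ENNReal.ofReal_natCast]
        exact ENNReal.ofReal_le_ofReal h2
  calc coverEntropyEntourage T Set.univ U
      ≤ ExpGrowth.expGrowthSup (fun n : ℕ => EReal.exp ((a : EReal) * n)) :=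
        ExpGrowth.expGrowthSup_le_of_eventually_le (ENNReal.natCast_ne_top C)
          (Eventually.of_forall hle)
    _ = a := ExpGrowth.expGrowthSup_exp
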